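/- Let σ = [v₀v₁…v_d] be a regular d-simplex in ℝⁿ (the convex hull of affinely independent points v₀,…,v_d whose pairwise distances are all equal). Then there exists a constant c > 0 depending only on d such that for every sufficiently small δ >4 0 — specifically, whenever c·δ·(d+1) < diam(σ) — the set σ_δ = { Σ_{i=0}^d t_i v_i : t_i ≥ c·δ/diam(σ) for all i, Σ_{i=0}^d t_i = 1 } is a regular d-simplex contained in { x ∈ σ : dist(x, ∂σ) ≥ δ }, and its diameter satisfies diam(σ_δ) = diam(σ) − c·δ·(d+1). -/

import Mathlib

open Metric Set

variable {n d : ℕ}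

/-- The `d`-simplex `[v₀ v₁ … v_d]`: the convex hull of the points `v i`. -/
def simplexOf (v : Fin (d + 1) → EuclideanSpace ℝ (Fin n)) :
    Set (EuclideanSpace ℝ (Fin n)) :=
  convexHull ℝ (Set.range v)

/-- The boundary `∂σ` of the simplex `[v₀ v₁ … v_d]` relative to its affine hull:
the union of its proper faces (equivalently, of its facets). -/
def simplexBdry (v : Fin (d + 1) → EuclideanSpace ℝ (Fin n)) :
    Set (EuclideanSpace ℝ (Fin n)) :=
  ⋃ i : Fin (d + 1), convexHull ℝ (v '' ({i}ᶜ))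

/-- The shrunk simplex `σ_δ = { Σ t_i v_i : t_i ≥ c·δ/diam σ, Σ t_i = 1 }`. -/
def simplexShrunk (v : Fin (d + 1) → EuclideanSpace ℝ (Fin n)) (c δ : ℝ) :
    Set (EuclideanSpace ℝ (Fin n)) :=
  {x | ∃ t : Fin (d + 1) → ℝ,
    (∀ i, c * δ / Metric.diam (simplexOf v) ≤ t i) ∧
    (∑ i, t i) = 1 ∧ x = ∑ i, t i • v i}

/-- For weights of sum zero, the squared norm of `∑ u i • v i` over equidistant points `v i`
is `e ^ 2 / 2 * ∑ u i ^ 2`. -/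
theorem norm_sq_sum_smul_of_equidistant {ι V : Type*} [Fintype ι]
    [NormedAddCommGroup V] [InnerProductSpace ℝ V] {v : ι → V} {e : ℝ}
    (hv : ∀ i j, i ≠ j → dist (v i) (v j) = e) {u : ι → ℝ} (hu : ∑ i, u i = 0) :
    ‖∑ i, u i • v i‖ ^ 2 = e ^ 2 / 2 * ∑ i, u i ^ 2 := by
  classical
  have h := inner_sum_smul_sum_smul_of_sum_eq_zero (s₁ := Finset.univ) (s₂ := Finset.univ)
    v hu v hu
  rw [← real_inner_self_eq_norm_sq, h]
  have key : ∀ i j, u i * u j * (‖v i - v j‖ * ‖v i - v j‖)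
      = e ^ 2 * (u i * u j) - if i = j then e ^ 2 * u i ^ 2 else 0 := by
    intro i j
    by_cases hij : i = j
    · subst hij; simp; ring
    · rw [← dist_eq_norm, hv i j hij]; simp [hij]; ring
  simp_rw [key, Finset.sum_sub_distrib, ← Finset.mul_sum, hu]
  simp [← Finset.mul_sum]
  ring

/-- Distinct points at a common positive distance are affinely independent. -/
theorem affineIndependent_of_equidistant {ι V : Type*} [Fintype ι]
    [NormedAddCommGroup V] [InnerProductSpace ℝ V] {v : ι → V} {e : ℝ} (he : 0 < e)
    (hv : ∀ i j, i ≠ j → dist (v i) (v j) = e) : AffineIndependent ℝ v := by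
  rw [affineIndependent_iff_of_fintype]
  intro u hu h0 i
  rw [Finset.weightedVSub_eq_linear_combination _ hu] at h0
  have h := norm_sq_sum_smul_of_equidistant hv hu
  rw [h0, norm_zero] at h
  have hs : ∑ i, u i ^ 2 = 0 := by
    have : e ^ 2 / 2 ≠ 0 := by positivity
    simpa [he.ne'] using h.symm
  have := (Finset.sum_eq_zero_iff_of_nonneg (fun i _ => sq_nonneg (u i))).1 hs i (Finset.mem_univ i)
  simpa using this

theorem mem_simplexOf_iff {v : Fin (d + 1) → EuclideanSpace ℝ (Fin n)}
    {x : EuclideanSpace ℝ (Fin n)} :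
    x ∈ simplexOf v ↔ ∃ t : Fin (d + 1) → ℝ, (∀ i, 0 ≤ t i) ∧ ∑ i, t i = 1 ∧
      x = ∑ i, t i • v i := by
  constructor
  · intro hx
    refine convexHull_min (t := {x | ∃ t : Fin (d + 1) → ℝ, (∀ i, 0 ≤ t i) ∧ ∑ i, t i = 1 ∧
      x = ∑ i, t i • v i}) ?_ ?_ hx
    · rintro _ ⟨j, rfl⟩
      exact ⟨Pi.single j 1, fun i => by rw [Pi.single_apply]; split_ifs <;> norm_num, by simp,
        by simp [Pi.single_apply]⟩
    · rintro _ ⟨s, hs0, hs1, rfl⟩ _ ⟨t, ht0, ht1, rfl⟩ a b ha hb hab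
      refine ⟨fun j => a * s j + b * t j,
        fun j => add_nonneg (mul_nonneg ha (hs0 j)) (mul_nonneg hb (ht0 j)), ?_, ?_⟩
      · rw [Finset.sum_add_distrib, ← Finset.mul_sum, ← Finset.mul_sum, hs1, ht1, mul_one, mul_one,
          hab]
      · simp [add_smul, mul_smul, Finset.sum_add_distrib, Finset.smul_sum]
  · rintro ⟨t, h0, h1, rfl⟩
    exact (convex_convexHull ℝ _).sum_mem (fun i _ => h0 i) h1
      fun i _ => subset_convexHull ℝ _ (mem_range_self i)

theorem exists_weights_of_mem_convexHull_facet {v : Fin (d + 1) → EuclideanSpace ℝ (Fin n)}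
    {i : Fin (d + 1)} {y : EuclideanSpace ℝ (Fin n)} (hy : y ∈ convexHull ℝ (v '' {i}ᶜ)) :
    ∃ s : Fin (d + 1) → ℝ, s i = 0 ∧ ∑ j, s j = 1 ∧ y = ∑ j, s j • v j := by
  refine convexHull_min (t := {y | ∃ s : Fin (d + 1) → ℝ, s i = 0 ∧ ∑ j, s j = 1 ∧
    y = ∑ j, s j • v j}) ?_ ?_ hy
  · rintro _ ⟨j, hj, rfl⟩
    refine ⟨Pi.single j 1, ?_, by simp, by simp [Pi.single_apply]⟩
    exact Pi.single_eq_of_ne (Ne.symm hj) 1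
  · rintro _ ⟨s, hs0, hs1, rfl⟩ _ ⟨t, ht0, ht1, rfl⟩ a b - - hab
    refine ⟨fun j => a * s j + b * t j, by simp [hs0, ht0], ?_, ?_⟩
    · rw [Finset.sum_add_distrib, ← Finset.mul_sum, ← Finset.mul_sum, hs1, ht1, mul_one, mul_one,
        hab]
    · simp [add_smul, mul_smul, Finset.sum_add_distrib, Finset.smul_sum]

theorem diam_simplexOf_of_equidistant {v : Fin (d + 1) → EuclideanSpace ℝ (Fin n)} {e : ℝ}
    (hd : d ≠ 0) (he : 0 < e) (hv : ∀ i j, i ≠ j → dist (v i) (v j) = e) :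
    diam (simplexOf v) = e := by
  rw [simplexOf, convexHull_diam]
  apply le_antisymm
  · refine diam_le_of_forall_dist_le he.le ?_
    rintro _ ⟨i, rfl⟩ _ ⟨j, rfl⟩
    by_cases hij : i = j
    · simp [hij, he.le]
    · exact (hv i j hij).le
  · have h01 : (0 : Fin (d + 1)) ≠ Fin.last d := by
      simpa [Fin.ext_iff] using hd.symm
    rw [← hv _ _ h01]
    exact dist_le_diam_of_mem (finite_range v).isBounded (mem_range_self _) (mem_range_self _)

/-- The vertices of the shrunk simplex with lower bound `η` on the barycentric coordinates. -/
def shrunkVertex (v : Fin (d + 1) → EuclideanSpace ℝ (Fin n)) (η : ℝ) (i : Fin (d + 1)) :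
    EuclideanSpace ℝ (Fin n) :=
  (1 - (d + 1) * η) • v i + ∑ j, η • v j

theorem dist_shrunkVertex (v : Fin (d + 1) → EuclideanSpace ℝ (Fin n)) {η : ℝ}
    (hη : (d + 1) * η ≤ 1) (i j : Fin (d + 1)) :
    dist (shrunkVertex v η i) (shrunkVertex v η j) = (1 - (d + 1) * η) * dist (v i) (v j) := by
  rw [shrunkVertex, shrunkVertex, dist_add_right, dist_smul₀, Real.norm_of_nonneg (by linarith)]

theorem simplexShrunk_eq_simplexOf {v : Fin (d + 1) → EuclideanSpace ℝ (Fin n)} {c δ η : ℝ}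
    (hη : c * δ / diam (simplexOf v) = η) (hη1 : (d + 1) * η < 1) :
    simplexShrunk v c δ = simplexOf (shrunkVertex v η) := by
  have hr : 0 < 1 - (d + 1) * η := by linarith
  have hsum : ∀ s : Fin (d + 1) → ℝ, ∑ i, s i = 1 →
      ∑ i, s i • shrunkVertex v η i = ∑ i, (η + (1 - (d + 1) * η) * s i) • v i := by
    intro s hs
    simp only [shrunkVertex, smul_add, Finset.sum_add_distrib, add_smul, ← Finset.sum_smul, hs,
      one_smul, smul_smul, mul_comm]
    rw [add_comm]
  ext x
  rw [mem_simplexOf_iff]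
  simp only [simplexShrunk, hη, mem_ofPred_eq]
  constructor
  · rintro ⟨t, ht, h1, rfl⟩
    have hs : ∑ i, (t i - η) / (1 - (d + 1) * η) = 1 := by
      rw [← Finset.sum_div, Finset.sum_sub_distrib, h1]
      simp [hr.ne']
    refine ⟨fun i => (t i - η) / (1 - (d + 1) * η),
      fun i => div_nonneg (sub_nonneg.2 (ht i)) hr.le, hs, ?_⟩
    rw [hsum _ hs]
    refine Finset.sum_congr rfl fun i _ => ?_
    rw [mul_div_cancel₀ _ hr.ne', add_sub_cancel]
  · rintro ⟨s, hs0, hs1, rfl⟩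
    refine ⟨fun i => η + (1 - (d + 1) * η) * s i,
      fun i => le_add_of_nonneg_right (mul_nonneg hr.le (hs0 i)), ?_, hsum s hs1⟩
    rw [Finset.sum_add_distrib, ← Finset.mul_sum, hs1]
    simp

/-- For every regular `d`-simplex `σ = [v₀…v_d]` in `ℝⁿ` there is a
constant `c > 0` depending only on `d` such that whenever `c·δ·(d+1) < diam σ`
(`δ > 0`), the set `σ_δ = {Σ t_i v_i : t_i ≥ c·δ/diam σ, Σ t_i = 1}` is a regular
`d`-simplex contained in `{x ∈ σ : dist(x,∂σ) ≥ δ}`, and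
`diam σ_δ = diam σ − c·δ·(d+1)`. -/
theorem regular_simplex_shrink (d : ℕ) :
    ∃ c > (0 : ℝ), ∀ (n : ℕ) (v : Fin (d + 1) → EuclideanSpace ℝ (Fin n)),
      AffineIndependent ℝ v →
      (∃ e : ℝ, 0 < e ∧ ∀ i j, i ≠ j → dist (v i) (v j) = e) →
      ∀ δ > (0 : ℝ), c * δ * (d + 1) < Metric.diam (simplexOf v) →
        (simplexShrunk v c δ
            ⊆ {x ∈ simplexOf v | δ ≤ Metric.infDist x (simplexBdry v)}) ∧
        (∃ w : Fin (d + 1) → EuclideanSpace ℝ (Fin n), AffineIndependent ℝ w ∧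
          (∃ e' : ℝ, 0 < e' ∧ ∀ i j, i ≠ j → dist (w i) (w j) = e') ∧
          simplexShrunk v c δ = simplexOf w) ∧
        Metric.diam (simplexShrunk v c δ)
          = Metric.diam (simplexOf v) - c * δ * (d + 1) := by
  refine ⟨2, two_pos, fun n v _ ⟨e, he, hv⟩ δ hδ hδd => ?_⟩
  have hd : d ≠ 0 := by
    rintro rfl
    have hsub : (range v).Subsingleton := by
      rintro _ ⟨i, rfl⟩ _ ⟨j, rfl⟩
      rw [Subsingleton.elim (α := Fin 1) i j]
    rw [simplexOf, convexHull_diam, diam_subsingleton hsub] at hδd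
    norm_num at hδd
    linarith
  have hdiam := diam_simplexOf_of_equidistant hd he hv
  rw [hdiam] at hδd
  set η : ℝ := 2 * δ / e with hηdef
  have hη : 2 * δ / diam (simplexOf v) = η := by rw [hdiam]
  have hη0 : 0 < η := by positivity
  have hηe : η * e = 2 * δ := div_mul_cancel₀ _ he.ne'
  have hη1 : (d + 1) * η < 1 := by
    rw [hηdef, ← mul_div_assoc, div_lt_one he]
    linarith
  have he' : 0 < (1 - (d + 1) * η) * e := mul_pos (by linarith) he
  have hw : ∀ i j, i ≠ j →
      dist (shrunkVertex v η i) (shrunkVertex v η j) = (1 - (d + 1) * η) * e := by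
    intro i j hij
    rw [dist_shrunkVertex v hη1.le, hv i j hij]
  have hshrunk := simplexShrunk_eq_simplexOf hη hη1
  refine ⟨?_, ⟨shrunkVertex v η, affineIndependent_of_equidistant he' hw, ⟨_, he', hw⟩, hshrunk⟩,
    ?_⟩
  · rintro _ ⟨t, ht, ht1, rfl⟩
    rw [hη] at ht
    refine ⟨mem_simplexOf_iff.2 ⟨t, fun i => hη0.le.trans (ht i), ht1, rfl⟩, ?_⟩
    have hne : (simplexBdry v).Nonempty := by
      refine ⟨v (Fin.last d), mem_iUnion.2 ⟨0, subset_convexHull ℝ _ ⟨Fin.last d, ?_, rfl⟩⟩⟩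
      simpa [Fin.ext_iff] using hd
    rw [le_infDist hne]
    intro y hy
    obtain ⟨i, hi⟩ := mem_iUnion.1 hy
    obtain ⟨s, hsi, hs1, rfl⟩ := exists_weights_of_mem_convexHull_facet hi
    have hu : ∑ j, (t j - s j) = 0 := by rw [Finset.sum_sub_distrib, ht1, hs1, sub_self]
    have hnorm := norm_sq_sum_smul_of_equidistant hv hu
    have hle : η ^ 2 ≤ ∑ j, (t j - s j) ^ 2 := by
      calc η ^ 2 ≤ (t i - s i) ^ 2 := by
            rw [hsi, sub_zero]
            exact pow_le_pow_left₀ hη0.le (ht i) 2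
        _ ≤ _ := Finset.single_le_sum (f := fun j => (t j - s j) ^ 2)
            (fun j _ => sq_nonneg _) (Finset.mem_univ i)
    rw [dist_eq_norm, ← Finset.sum_sub_distrib]
    simp_rw [← sub_smul]
    refine (sq_le_sq₀ hδ.le (norm_nonneg _)).1 ?_
    rw [hnorm]
    calc δ ^ 2 ≤ (η * e) ^ 2 / 2 := by rw [hηe]; nlinarith [sq_nonneg δ]
      _ = e ^ 2 / 2 * η ^ 2 := by ring
      _ ≤ _ := by gcongr
  · rw [hshrunk, diam_simplexOf_of_equidistant hd he' hw, hdiam]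
    linear_combination (-(d : ℝ) - 1) * hηe
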